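/- Fix an atomic concept name A ∈ N_C. There is no ALCι_L concept C such that for every interpretation I, C^I = (ιA.⊤)^I. Consequently, the ALCι_G concept ιA.⊤ has no equivalent ALCι_L concept, so ALCι_L is strictly less expressive than ALCι_G. -/

import Mathlib

universe u v

namespace DL

/-- ALCι concepts, with atomic concept names and role names both drawn from
the countably infinite (and disjoint, being distinct sorts) sets `ℕ`. -/
inductive Concept : Type
  | atom : ℕ → Concept
  | neg : Concept → Concept
  | conj : Concept → Concept → Concept
  | ex : ℕ → Concept → Concept
  | iotaL : Concept → Concept
  | iotaG : Concept → Concept → Concept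
  deriving DecidableEq

/-- An interpretation with (nonempty) domain `D`. -/
structure Interp (D : Type u) where
  atomI : ℕ → Set D
  roleI : ℕ → Set (D × D)

/-- The extension `C^I` of a concept `C` in the interpretation `I`. -/
def Interp.sem {D : Type u} (I : Interp D) : Concept → Set D
  | .atom A => I.atomI A
  | .neg C => (I.sem C)ᶜ
  | .conj C D' => I.sem C ∩ I.sem D'
  | .ex r C => {d | ∃ e, (d, e) ∈ I.roleI r ∧ e ∈ I.sem C}
  | .iotaL C => {d | I.sem C = {d}}
  | .iotaG C D' => {_d | ∃ e, I.sem C = {e} ∧ e ∈ I.sem D'}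

/-- Concepts not using the global definite description constructor `ιC.D`,
i.e. ALCι_L concepts. -/
def Concept.noG : Concept → Prop
  | .atom _ => True
  | .neg C => C.noG
  | .conj C D => C.noG ∧ D.noG
  | .ex _ C => C.noG
  | .iotaL C => C.noG
  | .iotaG _ _ => False

/-- Concepts not using the local definite description constructor `{ιC}`,
i.e. ALCι_G concepts. -/
def Concept.noL : Concept → Prop
  | .atom _ => True
  | .neg C => C.noL
  | .conj C D => C.noL ∧ D.noL
  | .ex _ C => C.noL
  | .iotaL _ => False
  | .iotaG C D => C.noL ∧ D.noL

/-- ALC concepts: neither local nor global definite descriptions. -/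
def Concept.isALC (C : Concept) : Prop := C.noG ∧ C.noL

/-- `⊤ := ¬(A ⊓ ¬A)` for the fixed atomic concept name `A`. -/
def top (A : ℕ) : Concept := .neg (.conj (.atom A) (.neg (.atom A)))

/-- The interpretation on a three-element domain with empty roles in which every atomic
concept name denotes `S`. -/
def roleFree (S : Set (ULift.{u} (Option Bool))) : Interp (ULift.{u} (Option Bool)) where
  atomI _ := S
  roleI _ := ∅

/-- With empty roles, an ALCι_L concept cannot tell apart the two elements outside of `{none}`,
nor can it detect there whether the atomic concept names denote `{none}` or `∅`. -/
theorem exists_forall_mem_sem_iff_of_noG (C : Concept) (hC : C.noG) :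
    ∃ p : Prop, ∀ b : Bool,
      (ULift.up (some b) ∈ (roleFree.{u} {ULift.up none}).sem C ↔ p) ∧
      (ULift.up (some b) ∈ (roleFree.{u} ∅).sem C ↔ p) := by
  induction C with
  | atom n => exact ⟨False, fun b => by simp [Interp.sem, roleFree]⟩
  | neg C ih =>
    obtain ⟨p, hp⟩ := ih hC
    exact ⟨¬p, fun b => ⟨not_congr (hp b).1, not_congr (hp b).2⟩⟩
  | conj C D ihC ihD =>
    obtain ⟨p, hp⟩ := ihC hC.1
    obtain ⟨q, hq⟩ := ihD hC.2
    exact ⟨p ∧ q, fun b => ⟨and_congr (hp b).1 (hq b).1, and_congr (hp b).2 (hq b).2⟩⟩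
  | ex r C _ => exact ⟨False, fun b => by simp [Interp.sem, roleFree]⟩
  | iotaL C ih =>
    obtain ⟨p, hp⟩ := ih hC
    have ne_singleton (S : Set (ULift.{u} (Option Bool)))
        (hS : ∀ b : Bool, ULift.up (some b) ∈ S ↔ p) (b : Bool) :
        S ≠ {ULift.up (some b)} := by
      rintro rfl
      have h := (hS !b).2 ((hS b).1 rfl)
      simp at h
    exact ⟨False, fun b => ⟨iff_false_intro (ne_singleton _ (fun b => (hp b).1) b),
      iff_false_intro (ne_singleton _ (fun b => (hp b).2) b)⟩⟩
  | iotaG C D _ _ => exact hC.elim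

/-- there is no ALCι_L concept equivalent to the ALCι_G concept
`ιA.⊤`; hence ALCι_L is strictly less expressive than ALCι_G. -/
theorem stmt6 (A : ℕ) :
    ¬ ∃ C : Concept, C.noG ∧
      ∀ (D : Type u) [Nonempty D] (I : Interp D),
        I.sem C = I.sem (.iotaG (.atom A) (top A)) := by
  rintro ⟨C, hC, h⟩
  obtain ⟨p, hp⟩ := exists_forall_mem_sem_iff_of_noG.{u} C hC
  have mem_iff := (hp true).1.trans (hp true).2.symm
  rw [h, h] at mem_iff
  obtain ⟨e, he, -⟩ := mem_iff.1 ⟨ULift.up none, rfl, fun hn => hn.2 hn.1⟩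
  exact Set.singleton_ne_empty e he.symm

end DL
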